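/- arXiv:2204.13882 — 2 statements merged into one kernel-verified Lean document; each statement's English description precedes it below -/
import Mathlib

section
/- Let p ≥ 5 be a prime, q = p^n a prime power, and let m = k·l with k ≥ 70 a divisor of q − 1 and l ≥ 1 equal to the multiplicative order of q modulo m. Let a ∈ F_q* be such that x^m − a is irreducible over F_q. Then there exists a nonzero element of the field F_q[x]/⟨x^m − a⟩ whose multiplicative order is at least 5^{(m/2)^{1/3}}. -/
open Polynomial

/-- In every box `{0, …, c}^N`, at least half of the points have weighted sum at most the mean. -/
lemma pow_le_two_mul_card_weighted_sum_le (N c : ℕ) (w : Fin N → ℕ) :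
    (c + 1) ^ N ≤ 2 * (Finset.univ.filter fun u : Fin N → Fin (c + 1) =>
      2 * ∑ j, (u j : ℕ) * w j ≤ c * ∑ j, w j).card := by
  classical
  set P : (Fin N → Fin (c + 1)) → Prop := fun u => 2 * ∑ j, (u j : ℕ) * w j ≤ c * ∑ j, w j
  have hrev (u : Fin N → Fin (c + 1)) :
      ∑ j, ((u j).rev : ℕ) * w j + ∑ j, (u j : ℕ) * w j = c * ∑ j, w j := by
    rw [← Finset.sum_add_distrib, Finset.mul_sum]
    refine Finset.sum_congr rfl fun j _ => ?_
    rw [← add_mul, Fin.val_rev]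
    congr 1
    have := (u j).isLt
    omega
  have hle : (Finset.univ.filter fun u => ¬ P u).card ≤ (Finset.univ.filter P).card := by
    refine Finset.card_le_card_of_injOn (fun u j => (u j).rev) ?_ ?_
    · intro u hu
      simp only [Finset.coe_filter, Finset.mem_univ, true_and, Set.mem_ofPred_eq, P] at hu ⊢
      have := hrev u
      omega
    · intro u _ v _ huv
      funext j
      exact Fin.rev_injective (congrFun huv j)
  have hsum := Finset.card_filter_add_card_filter_not
    (s := (Finset.univ : Finset (Fin N → Fin (c + 1)))) P
  simp only [Finset.card_univ, Fintype.card_fun, Fintype.card_fin] at hsum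
  change (c + 1) ^ N ≤ 2 * (Finset.univ.filter P).card
  omega

lemma card_le_orderOf_of_injOn_pow {M ι : Type*} [Monoid M] {γ : M} (hγ : IsOfFinOrder γ)
    (s : Finset ι) (E : ι → ℕ) (hinj : Set.InjOn (fun u => γ ^ E u) s) :
    s.card ≤ orderOf γ := by
  rw [← Finset.card_range (orderOf γ)]
  refine Finset.card_le_card_of_injOn (fun u => E u % orderOf γ) ?_ ?_
  · intro u _
    simpa using Nat.mod_lt _ hγ.orderOf_pos
  · intro u hu v hv huv
    refine hinj hu hv ?_
    simp only at huv ⊢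
    rw [← pow_mod_orderOf, huv, pow_mod_orderOf]

lemma X_pow_succ_dvd_one_add_pow_sub {R : Type*} [CommRing R] (c : R) {w : ℕ} (hw : 0 < w)
    (u : ℕ) : (X : R[X]) ^ (w + 1) ∣ (1 + C c * X ^ w) ^ u - (1 + (u : R[X]) * (C c * X ^ w)) := by
  induction u with
  | zero => simp
  | succ u ih =>
    have hdvd : (X : R[X]) ^ (w + 1) ∣ (u : R[X]) * C c ^ 2 * X ^ (2 * w) :=
      (pow_dvd_pow X (by omega)).mul_left _
    have := (ih.mul_right (1 + C c * X ^ w)).add hdvd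
    convert this using 1
    push_cast
    ring

lemma X_pow_dvd_prod_sub_one {R ι : Type*} [CommRing R] (s : Finset ι) (d : ℕ) (f : ι → R[X])
    (h : ∀ j ∈ s, X ^ d ∣ f j - 1) : X ^ d ∣ ∏ j ∈ s, f j - 1 := by
  classical
  induction s using Finset.induction_on with
  | empty => simp
  | insert i s hi ih =>
    rw [Finset.prod_insert hi]
    have h₁ := (h i (Finset.mem_insert_self i s)).mul_right (∏ j ∈ s, f j)
    have h₂ := ih fun j hj => h j (Finset.mem_insert_of_mem hj)
    convert h₁.add h₂ using 1
    ring

/-- Products of powers of the binomials `1 + cⱼ X ^ wⱼ`, with increasing degrees and exponents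
below the characteristic, determine the exponents. -/
lemma eq_of_prod_one_add_pow_eq {F : Type*} [Field F] (p : ℕ) [CharP F p] {N : ℕ}
    (c : Fin N → F) (hc : ∀ j, c j ≠ 0) (w : Fin N → ℕ) (hw : StrictMono w) (hpos : ∀ j, 0 < w j)
    (u v : Fin N → ℕ) (hu : ∀ j, u j < p) (hv : ∀ j, v j < p)
    (h : ∏ j, (1 + C (c j) * X ^ w j) ^ u j = ∏ j, (1 + C (c j) * X ^ w j) ^ v j) : u = v := by
  induction N with
  | zero => exact Subsingleton.elim _ _
  | succ N ih =>
    rw [Fin.prod_univ_succ, Fin.prod_univ_succ] at h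
    have htail (t : Fin (N + 1) → ℕ) :
        X ^ (w 0 + 1) ∣ ∏ j : Fin N, (1 + C (c j.succ) * X ^ w j.succ) ^ t j.succ - 1 := by
      refine X_pow_dvd_prod_sub_one _ _ _ fun j _ => ?_
      have h₁ : (X : F[X]) ^ (w 0 + 1) ∣ 1 + C (c j.succ) * X ^ w j.succ - 1 := by
        rw [add_sub_cancel_left]
        exact (pow_dvd_pow X (hw (Fin.succ_pos j))).mul_left _
      have h₂ := sub_dvd_pow_sub_pow (1 + C (c j.succ) * X ^ w j.succ) 1 (t j.succ)
      rw [one_pow] at h₂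
      exact h₁.trans h₂
    have hhead (t : Fin (N + 1) → ℕ) :
        X ^ (w 0 + 1) ∣ (1 + C (c 0) * X ^ w 0) ^ t 0 *
          ∏ j : Fin N, (1 + C (c j.succ) * X ^ w j.succ) ^ t j.succ
          - (1 + (t 0 : F[X]) * (C (c 0) * X ^ w 0)) := by
      convert ((htail t).mul_left ((1 + C (c 0) * X ^ w 0) ^ t 0)).add
        (X_pow_succ_dvd_one_add_pow_sub (c 0) (hpos 0) (t 0)) using 1
      ring
    have hdiff := (hhead v).sub (hhead u)
    rw [h] at hdiff
    have hcoeff := X_pow_dvd_iff.1 hdiff (w 0) (Nat.lt_succ_self _)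
    have h₀ : (u 0 : F) = v 0 := by
      have : (u 0 : F[X]) * (C (c 0) * X ^ w 0) - (v 0 : F[X]) * (C (c 0) * X ^ w 0)
          = C (((u 0 : F) - v 0) * c 0) * X ^ w 0 := by
        simp only [map_mul, map_sub, map_natCast]
        ring
      rw [show ∀ A B D : F[X], A - (1 + B) - (A - (1 + D)) = D - B by intros; ring, this,
        coeff_C_mul_X_pow, if_pos rfl, mul_eq_zero] at hcoeff
      exact sub_eq_zero.1 (hcoeff.resolve_right (hc 0))
    have h₀' : u 0 = v 0 := CharP.natCast_injOn_Iio F p (hu 0) (hv 0) h₀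
    have hne : (1 + C (c 0) * X ^ w 0 : F[X]) ^ v 0 ≠ 0 := by
      refine pow_ne_zero _ fun hz => ?_
      have := congrArg (fun f => coeff f 0) hz
      simp [(hpos 0).ne] at this
    rw [h₀'] at h
    have := ih (fun j => c j.succ) (fun j => hc _) (fun j => w j.succ)
      (fun i j hij => hw (Fin.succ_lt_succ_iff.2 hij)) (fun j => hpos _)
      (fun j => u j.succ) (fun j => v j.succ) (fun j => hu _) (fun j => hv _)
      (mul_left_cancel₀ hne h)
    funext j
    refine Fin.cases h₀' (fun i => congrFun this i) j

lemma eq_of_prod_pow_eq_of_pairwise_isCoprime {R ι : Type*} [CommRing R] [IsDomain R]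
    [Fintype ι] (f : ι → R) (hf : Pairwise fun i j => IsCoprime (f i) (f j))
    (hunit : ∀ i, ¬ IsUnit (f i)) (hne : ∀ i, f i ≠ 0) (u v : ι → ℕ)
    (h : ∏ j, f j ^ u j = ∏ j, f j ^ v j) : u = v := by
  classical
  have hle (u v : ι → ℕ) (h : ∏ j, f j ^ u j = ∏ j, f j ^ v j) (i : ι) : v i ≤ u i := by
    by_contra! hlt
    rw [← Finset.mul_prod_erase _ _ (Finset.mem_univ i),
      ← Finset.mul_prod_erase _ (fun j => f j ^ v j) (Finset.mem_univ i),
      ← Nat.add_sub_of_le hlt.le, pow_add, mul_assoc] at h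
    have h' := mul_left_cancel₀ (pow_ne_zero _ (hne i)) h
    have hdvd : f i ∣ ∏ j ∈ Finset.univ.erase i, f j ^ u j := by
      rw [h']
      exact (dvd_pow_self _ (by omega)).mul_right _
    have hcop : IsCoprime (f i) (∏ j ∈ Finset.univ.erase i, f j ^ u j) :=
      IsCoprime.prod_right fun j hj => (hf (Finset.ne_of_mem_erase hj).symm).pow_right
    exact hunit i (hcop.isUnit_of_dvd' dvd_rfl hdvd)
  exact funext fun i => le_antisymm (hle v u h.symm i) (hle u v h i)

section AdjoinRoot

variable {F : Type*} [Field F] {m : ℕ} {a : F}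

lemma root_pow_eq_of_X_pow_sub_C (m : ℕ) (a : F) :
    AdjoinRoot.root (X ^ m - C a) ^ m = AdjoinRoot.of (X ^ m - C a) a := by
  have := AdjoinRoot.eval₂_root (X ^ m - C a)
  simpa [sub_eq_zero] using this

lemma mk_X_pow_sub_C_injOn {f g : F[X]} (hf : f.natDegree < m)
    (hg : g.natDegree < m)
    (h : AdjoinRoot.mk (X ^ m - C a) f = AdjoinRoot.mk (X ^ m - C a) g) : f = g := by
  rw [AdjoinRoot.mk_eq_mk] at h
  refine sub_eq_zero.1 (eq_zero_of_dvd_of_natDegree_lt h ?_)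
  rw [natDegree_X_pow_sub_C]
  exact (natDegree_sub_le f g).trans_lt (max_lt hf hg)

lemma isOfFinOrder_of_ne_zero [Finite F] (hirr : Irreducible (X ^ m - C a))
    {γ : AdjoinRoot (X ^ m - C a)} (hγ : γ ≠ 0) : IsOfFinOrder γ := by
  have := Fact.mk hirr
  have : Module.Finite F (AdjoinRoot (X ^ m - C a)) :=
    (AdjoinRoot.powerBasis hirr.ne_zero).finite
  have : Finite (AdjoinRoot (X ^ m - C a)) := Module.finite_of_finite F
  have := isOfFinOrder_of_finite (Units.mk0 γ hγ)
  exact Units.isOfFinOrder_val.2 this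

lemma one_add_root_pow_ne_zero (hm : 0 < m) {d : ℕ} (hd : 0 < d) (hdm : d < m) :
    1 + AdjoinRoot.root (X ^ m - C a) ^ d ≠ 0 := by
  intro h
  have h' : AdjoinRoot.mk (X ^ m - C a) (X ^ d + C 1) = AdjoinRoot.mk (X ^ m - C a) 0 := by
    simpa [add_comm] using h
  have := mk_X_pow_sub_C_injOn (by rwa [natDegree_X_pow_add_C]) (by simpa using hm) h'
  exact X_pow_add_C_ne_zero hd 1 this

/-- If many conjugates of `γ` are binomials `1 + cⱼ θ ^ wⱼ` of small weighted degree with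
multiplicatively independent polynomial lifts, then `γ` has large order. -/
lemma pow_le_two_mul_orderOf {γ : AdjoinRoot (X ^ m - C a)} (hγ : IsOfFinOrder γ)
    (N b : ℕ) (c : Fin N → F) (w e : Fin N → ℕ)
    (hpow : ∀ j, γ ^ e j = AdjoinRoot.mk (X ^ m - C a) (1 + C (c j) * X ^ w j))
    (hdeg : b * ∑ j, w j < 2 * m)
    (hinj : ∀ u v : Fin N → Fin (b + 1),
      ∏ j, (1 + C (c j) * X ^ w j) ^ (u j : ℕ) = ∏ j, (1 + C (c j) * X ^ w j) ^ (v j : ℕ) →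
        u = v) :
    (b + 1) ^ N ≤ 2 * orderOf γ := by
  refine (pow_le_two_mul_card_weighted_sum_le N b w).trans (Nat.mul_le_mul_left 2 ?_)
  refine card_le_orderOf_of_injOn_pow hγ _ (fun u => ∑ j, e j * (u j : ℕ)) ?_
  have hmk (u : Fin N → Fin (b + 1)) : γ ^ (∑ j, e j * (u j : ℕ)) =
      AdjoinRoot.mk (X ^ m - C a) (∏ j, (1 + C (c j) * X ^ w j) ^ (u j : ℕ)) := by
    rw [map_prod, ← Finset.prod_pow_eq_pow_sum]
    exact Finset.prod_congr rfl fun j _ => by rw [pow_mul, hpow, map_pow]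
  have hnat (u : Fin N → Fin (b + 1)) (hu : 2 * ∑ j, (u j : ℕ) * w j ≤ b * ∑ j, w j) :
      (∏ j, (1 + C (c j) * X ^ w j) ^ (u j : ℕ)).natDegree < m := by
    refine lt_of_le_of_lt ((natDegree_prod_le _ _).trans
      (Finset.sum_le_sum fun j _ => (?_ : _ ≤ (u j : ℕ) * w j))) (by omega)
    refine natDegree_pow_le_of_le _ ((natDegree_add_le _ _).trans ?_)
    simpa using natDegree_C_mul_X_pow_le (c j) (w j)
  intro u hu v hv huv
  simp only [Finset.coe_filter, Finset.mem_univ, true_and, Set.mem_ofPred_eq] at hu hv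
  simp only [hmk] at huv
  exact hinj u v (mk_X_pow_sub_C_injOn (hnat u hu) (hnat v hv) huv)

lemma one_add_pow_card_pow [Fintype F] (hirr : Irreducible (X ^ m - C a))
    (x : AdjoinRoot (X ^ m - C a)) (i : ℕ) :
    (1 + x) ^ Fintype.card F ^ i = 1 + x ^ Fintype.card F ^ i := by
  have := Fact.mk hirr
  obtain ⟨p, hchar⟩ := CharP.exists F
  obtain ⟨n, hp, hcard⟩ := FiniteField.card F p
  have := Fact.mk hp
  have : CharP (AdjoinRoot (X ^ m - C a)) p :=
    charP_of_injective_algebraMap (algebraMap F (AdjoinRoot (X ^ m - C a))).injective p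
  rw [hcard, ← pow_mul, add_pow_char_pow, one_pow]

/-- Irreducibility of `X ^ m - a` forces `a ^ ((q - 1) / k)` to have order exactly `k`. -/
lemma orderOf_pow_card_sub_one_div [Fintype F] (ha : a ≠ 0) (hirr : Irreducible (X ^ m - C a))
    {k t : ℕ} (hk : 0 < k) (hkm : k ∣ m) (ht : Fintype.card F = 1 + k * t) :
    orderOf (a ^ t) = k := by
  classical
  have hcard : Fintype.card F - 1 = k * t := by omega
  have hone : (a ^ t) ^ k = 1 := by
    rw [← pow_mul, mul_comm, ← hcard, FiniteField.pow_card_sub_one_eq_one a ha]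
  obtain ⟨d, hd⟩ := orderOf_dvd_of_pow_eq_one hone
  set e := orderOf (a ^ t) with he
  have he0 : 0 < e := Nat.pos_of_ne_zero fun h => by simp [h] at hd; omega
  have ht0 : 0 < t := Nat.pos_of_ne_zero fun h => by
    have := Fintype.one_lt_card (α := F)
    simp [h] at ht
    omega
  by_contra hne
  have hd1 : d ≠ 1 := fun h => hne (by rw [hd, h, mul_one])
  obtain ⟨g, hg⟩ := IsCyclic.exists_generator (α := Fˣ)
  obtain ⟨s, hs⟩ := (mem_powers_iff_mem_zpowers.2 (hg (Units.mk0 a ha)))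
  simp only at hs
  have hgord : orderOf g = k * t := by
    rw [orderOf_eq_card_of_forall_mem_zpowers hg, Nat.card_eq_fintype_card, Fintype.card_units,
      hcard]
  have hae : g ^ (s * (t * e)) = 1 := by
    rw [pow_mul, hs]
    ext
    simp only [Units.val_pow_eq_pow_val, Units.val_mk0, Units.val_one]
    rw [pow_mul, he, pow_orderOf_eq_one]
  have hdvd := orderOf_dvd_of_pow_eq_one hae
  rw [hgord, hd, show e * d * t = d * (t * e) by ring] at hdvd
  obtain ⟨r, rfl⟩ := Nat.dvd_of_mul_dvd_mul_right (by positivity) hdvd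
  refine pow_ne_of_irreducible_X_pow_sub_C hirr ((Dvd.intro_left e hd.symm).trans hkm) hd1
    (b := ((g ^ r : Fˣ) : F)) ?_
  rw [← Units.val_pow_eq_pow_val, ← pow_mul, mul_comm, hs, Units.val_mk0]

/-- Lower bound for the order of `1 + θ ^ l`, whose conjugates are `1 + ζ ^ i θ ^ l`. -/
lemma three_pow_le_two_mul_orderOf [Fintype F] (ha : a ≠ 0)
    (hirr : Irreducible (X ^ m - C a)) {k l : ℕ} (hk : 1 < k) (hl : 0 < l) (hm : m = k * l)
    (hkdvd : k ∣ Fintype.card F - 1) :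
    3 ^ (k - 1) ≤ 2 * orderOf (1 + AdjoinRoot.root (X ^ m - C a) ^ l) := by
  have hm0 : 0 < m := hm ▸ by positivity
  have hlm : l < m := by rw [hm]; nlinarith
  obtain ⟨t, ht⟩ := hkdvd
  have hcard : Fintype.card F = 1 + k * t := by
    have := Fintype.one_lt_card (α := F)
    omega
  have hord := orderOf_pow_card_sub_one_div ha hirr (by omega) (Dvd.intro l hm.symm) hcard
  have hfrob (i : ℕ) : (AdjoinRoot.root (X ^ m - C a) ^ l) ^ Fintype.card F ^ i =
      AdjoinRoot.of (X ^ m - C a) ((a ^ t) ^ i) * AdjoinRoot.root (X ^ m - C a) ^ l := by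
    induction i with
    | zero => simp
    | succ i ih =>
      have hq : (AdjoinRoot.root (X ^ m - C a) ^ l) ^ Fintype.card F =
          AdjoinRoot.of (X ^ m - C a) (a ^ t) * AdjoinRoot.root (X ^ m - C a) ^ l := by
        rw [hcard, ← pow_mul, map_pow, ← root_pow_eq_of_X_pow_sub_C, ← pow_mul, ← pow_add]
        congr 1
        rw [hm]
        ring
      rw [pow_succ (Fintype.card F), pow_mul, ih, mul_pow, hq, ← map_pow,
        FiniteField.pow_card, pow_succ (a ^ t), map_mul, mul_assoc]
  have hζ (i : Fin (k - 1)) : (a ^ t) ^ (i : ℕ) ≠ 0 := pow_ne_zero _ (pow_ne_zero _ ha)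
  refine pow_le_two_mul_orderOf
    (isOfFinOrder_of_ne_zero hirr (one_add_root_pow_ne_zero hm0 hl hlm)) (k - 1) 2
    (fun i => (a ^ t) ^ (i : ℕ)) (fun _ => l) (fun i => Fintype.card F ^ (i : ℕ)) ?_ ?_ ?_
  · intro i
    rw [one_add_pow_card_pow hirr, hfrob]
    simp [AdjoinRoot.mk_C]
  · simp only [Finset.sum_const, Finset.card_univ, Fintype.card_fin, smul_eq_mul]
    have : (k - 1) * l < m := by
      rw [hm]
      exact Nat.mul_lt_mul_of_pos_right (by omega) hl
    omega
  · intro u v huv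
    have hdeg (i : Fin (k - 1)) :
        (1 + C ((a ^ t) ^ (i : ℕ)) * X ^ l : F[X]).natDegree = l := by
      rw [add_comm, ← C_1, natDegree_add_C, natDegree_C_mul_X_pow _ _ (hζ i)]
    have := eq_of_prod_pow_eq_of_pairwise_isCoprime _ ?_ ?_ ?_ _ _ huv
    · exact funext fun i => Fin.ext (congrFun this i)
    · intro i j hij
      have hne : (a ^ t) ^ (j : ℕ) - (a ^ t) ^ (i : ℕ) ≠ 0 := fun h => hij <| Fin.ext <|
        (pow_injOn_Iio_orderOf (by simp [hord]; omega) (by simp [hord]; omega)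
          (sub_eq_zero.1 h)).symm
      refine ⟨C (((a ^ t) ^ (j : ℕ) - (a ^ t) ^ (i : ℕ))⁻¹ * (a ^ t) ^ (j : ℕ)),
        -C (((a ^ t) ^ (j : ℕ) - (a ^ t) ^ (i : ℕ))⁻¹ * (a ^ t) ^ (i : ℕ)), ?_⟩
      generalize (a ^ t) ^ (j : ℕ) = y at *
      generalize (a ^ t) ^ (i : ℕ) = x at *
      have hinv : C (y - x)⁻¹ * (C y - C x) = 1 := by
        rw [← C_sub, ← C_mul, inv_mul_cancel₀ hne, C_1]
      simp only [C_mul]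
      linear_combination hinv
    · intro i hi
      have := natDegree_eq_zero_of_isUnit hi
      rw [hdeg] at this
      omega
    · intro i hi
      have := hdeg i
      rw [hi] at this
      simp at this
      omega

/-- The powers of `q` modulo `m = k l` exhaust the residues congruent to `1` modulo `k`. -/
lemma exists_pow_mod_eq {q m k l : ℕ} (hk : 1 < k) (hl : 0 < l) (hm : m = k * l) (hq : 0 < q)
    (hkdvd : k ∣ q - 1) (hord : orderOf (q : ZMod m) = l) {j : ℕ} (hj : j < l) :
    ∃ i, q ^ i % m = 1 + k * j := by
  have hm0 : 0 < m := hm ▸ by positivity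
  have hq1 : q ≡ 1 [MOD k] := ((Nat.modEq_iff_dvd' hq).2 hkdvd).symm
  have hmod (i : ℕ) : q ^ i % m % k = 1 := by
    rw [Nat.mod_mod_of_dvd _ (Dvd.intro l hm.symm)]
    have := hq1.pow i
    rw [one_pow] at this
    rw [this, Nat.mod_eq_of_lt hk]
  have hdecomp (i : ℕ) : q ^ i % m = 1 + k * (q ^ i % m / k) := by
    have := Nat.mod_add_div (q ^ i % m) k
    rw [hmod] at this
    exact this.symm
  have hmaps : ∀ i ∈ Finset.range l, q ^ i % m / k ∈ Finset.range l := by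
    intro i _
    rw [Finset.mem_range, Nat.div_lt_iff_lt_mul (by omega), mul_comm, ← hm]
    exact Nat.mod_lt _ hm0
  have hinj : Set.InjOn (fun i => q ^ i % m / k) (Finset.range l) := by
    intro i hi j hj hij
    simp only [Finset.coe_range, Set.mem_Iio] at hi hj
    have hij' : q ^ i ≡ q ^ j [MOD m] := by
      change q ^ i % m = q ^ j % m
      rw [hdecomp i, hdecomp j]
      simp only at hij
      rw [hij]
    have := (ZMod.natCast_eq_natCast_iff _ _ _).2 hij'
    push_cast at this
    exact pow_injOn_Iio_orderOf (by simpa [hord] using hi) (by simpa [hord] using hj) this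
  obtain ⟨i, -, hi⟩ := Finset.surjOn_of_injOn_of_card_le _ hmaps hinj le_rfl
    (Finset.mem_coe.2 (Finset.mem_range.2 hj))
  exact ⟨i, by rw [hdecomp i]; simp only at hi; rw [hi]⟩

/-- Lower bound for the order of `1 + θ`, whose conjugates are `1 + cⱼ θ ^ (1 + k j)`. -/
lemma five_pow_sqrt_le_two_mul_orderOf [Fintype F] {p : ℕ} (hp5 : 5 ≤ p) [CharP F p]
    (ha : a ≠ 0) (hirr : Irreducible (X ^ m - C a)) {k l : ℕ} (hk : 2 < k) (hl : 0 < l)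
    (hm : m = k * l) (hkdvd : k ∣ Fintype.card F - 1)
    (hord : orderOf (Fintype.card F : ZMod m) = l) :
    5 ^ l.sqrt ≤ 2 * orderOf (1 + AdjoinRoot.root (X ^ m - C a)) := by
  have hm0 : 0 < m := hm ▸ by positivity
  have hm1 : 1 < m := by rw [hm]; nlinarith
  have hne := one_add_root_pow_ne_zero (a := a) hm0 one_pos hm1
  rw [pow_one] at hne
  have hconj (j : Fin l.sqrt) :
      ∃ i, Fintype.card F ^ i % m = 1 + k * j :=
    exists_pow_mod_eq (by omega) hl hm Fintype.card_pos hkdvd hord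
      (j.isLt.trans_le (Nat.sqrt_le_self l))
  choose i hi using hconj
  refine pow_le_two_mul_orderOf (isOfFinOrder_of_ne_zero hirr hne) l.sqrt 4
    (fun j => a ^ (Fintype.card F ^ i j / m)) (fun j => 1 + k * j)
    (fun j => Fintype.card F ^ i j) ?_ ?_ ?_
  · intro j
    rw [one_add_pow_card_pow hirr]
    conv_lhs => rw [← Nat.div_add_mod (Fintype.card F ^ i j) m]
    rw [pow_add, pow_mul, root_pow_eq_of_X_pow_sub_C, hi]
    simp [AdjoinRoot.mk_C]
  · rw [Finset.sum_add_distrib, ← Finset.mul_sum, Fin.sum_univ_eq_sum_range (fun j => j)]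
    simp only [Finset.sum_const, Finset.card_univ, Fintype.card_fin, smul_eq_mul, mul_one]
    have hsum := Finset.sum_range_id_mul_two l.sqrt
    have hsq := Nat.sqrt_le' l
    have hs : 0 < l.sqrt := Nat.sqrt_pos.2 hl
    generalize l.sqrt = H at *
    obtain ⟨h, rfl⟩ : ∃ h, H = h + 1 := ⟨H - 1, by omega⟩
    rw [Nat.add_sub_cancel] at hsum
    have h₁ : k * (h + 1) ^ 2 ≤ m := hm ▸ Nat.mul_le_mul_left k hsq
    have h₂ : 4 * (k * ∑ j ∈ Finset.range (h + 1), j) = 2 * (k * ((h + 1) * h)) := by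
      rw [← hsum]
      ring
    nlinarith
  · intro u v huv
    have := eq_of_prod_one_add_pow_eq p _ (fun j => pow_ne_zero _ ha) _
      (fun x y hxy => by gcongr; exact hxy) (fun j => by omega) (fun j => (u j : ℕ))
      (fun j => (v j : ℕ)) (fun j => by have := (u j).isLt; omega)
      (fun j => by have := (v j).isLt; omega) huv
    exact funext fun j => Fin.ext (congrFun this j)

end AdjoinRoot

lemma five_rpow_cbrt_le_of_two_mul_le_sq {k l o : ℕ} (hk : 70 ≤ k) (hl : 2 * l ≤ k ^ 2)
    (ho : 3 ^ (k - 1) ≤ 2 * o) :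
    (5 : ℝ) ^ ((((k * l : ℕ) : ℝ) / 2) ^ ((1 : ℝ) / 3)) ≤ o := by
  set x : ℝ := (((k * l : ℕ) : ℝ) / 2) ^ ((1 : ℝ) / 3) with hx
  have hx0 : 0 ≤ x := by positivity
  have hx3 : x ^ 3 = ((k * l : ℕ) : ℝ) / 2 := by
    rw [hx, ← Real.rpow_natCast, ← Real.rpow_mul (by positivity)]
    norm_num
  have hlR : 2 * (l : ℝ) ≤ (k : ℝ) ^ 2 := by exact_mod_cast hl
  have hk0 : (0 : ℝ) ≤ k := by positivity
  have hxk : 3 * x ≤ 2 * k := by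
    refine le_of_pow_le_pow_left₀ three_ne_zero (by positivity) ?_
    rw [mul_pow, hx3]
    push_cast
    nlinarith [mul_le_mul_of_nonneg_left hlR hk0, pow_nonneg hk0 3]
  have hpow : (216 : ℝ) * 25 ^ k ≤ 27 ^ k := by
    obtain ⟨j, rfl⟩ := Nat.exists_eq_add_of_le hk
    rw [pow_add, pow_add, ← mul_assoc]
    gcongr <;> norm_num
  have h3 : (3 : ℝ) ^ k ≤ 6 * o := by
    have : (3 : ℝ) ^ (k - 1) ≤ 2 * o := by exact_mod_cast ho
    rw [show k = k - 1 + 1 by omega, pow_succ]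
    linarith
  refine le_of_pow_le_pow_left₀ three_ne_zero (by positivity) ?_
  have h5 : ((5 : ℝ) ^ x) ^ 3 ≤ 25 ^ k := by
    rw [← Real.rpow_natCast, ← Real.rpow_mul (by norm_num), show (25 : ℝ) = 5 ^ 2 by norm_num,
      ← pow_mul, ← Real.rpow_natCast]
    refine Real.rpow_le_rpow_of_exponent_le (by norm_num) ?_
    push_cast
    linarith
  have h27 : (27 : ℝ) ^ k ≤ (6 * o) ^ 3 := by
    calc (27 : ℝ) ^ k = (3 ^ k) ^ 3 := by rw [← pow_mul, mul_comm, pow_mul]; norm_num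
      _ ≤ _ := by gcongr
  rw [mul_pow] at h27
  linarith

lemma five_rpow_cbrt_le_of_sq_le_two_mul {k l o : ℕ} (hk : 70 ≤ k) (hl : k ^ 2 ≤ 2 * l)
    (ho : 5 ^ l.sqrt ≤ 2 * o) :
    (5 : ℝ) ^ ((((k * l : ℕ) : ℝ) / 2) ^ ((1 : ℝ) / 3)) ≤ o := by
  set x : ℝ := (((k * l : ℕ) : ℝ) / 2) ^ ((1 : ℝ) / 3) with hx
  have hx0 : 0 ≤ x := by positivity
  have hx3 : x ^ 3 = ((k * l : ℕ) : ℝ) / 2 := by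
    rw [hx, ← Real.rpow_natCast, ← Real.rpow_mul (by positivity)]
    norm_num
  have hlR : (k : ℝ) ^ 2 ≤ 2 * (l : ℝ) := by exact_mod_cast hl
  have hH : 49 ≤ l.sqrt := Nat.le_sqrt.2 (by nlinarith)
  have hlt : (l : ℝ) ≤ ((l.sqrt : ℝ) + 1) ^ 2 := by
    exact_mod_cast (Nat.lt_succ_sqrt' l).le
  obtain ⟨h, hh⟩ : ∃ h, l.sqrt = h + 1 := ⟨l.sqrt - 1, by omega⟩
  rw [hh] at ho hlt hH
  have hh48 : (48 : ℝ) ≤ h := by exact_mod_cast (by omega : 48 ≤ h)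
  have hxh : x ≤ h := by
    refine le_of_pow_le_pow_left₀ (n := 6) (by norm_num) (by positivity) ?_
    calc x ^ 6 = (x ^ 3) ^ 2 := by ring
      _ = (k : ℝ) ^ 2 * (l : ℝ) ^ 2 / 4 := by rw [hx3]; push_cast; ring
      _ ≤ (2 * l) * (l : ℝ) ^ 2 / 4 := by gcongr
      _ = (l : ℝ) ^ 3 / 2 := by ring
      _ ≤ (((h : ℝ) + 2) ^ 2) ^ 3 / 2 := by
        gcongr
        push_cast at hlt
        linarith
      _ = ((h : ℝ) + 2) ^ 6 / 2 := by ring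
      _ ≤ ((25 / 24) * (h : ℝ)) ^ 6 / 2 := by gcongr; linarith
      _ = (25 / 24) ^ 6 / 2 * (h : ℝ) ^ 6 := by ring
      _ ≤ 1 * (h : ℝ) ^ 6 := by gcongr; norm_num
      _ = (h : ℝ) ^ 6 := one_mul _
  have h5 : (5 : ℝ) ^ x ≤ 5 ^ h := by
    rw [← Real.rpow_natCast]
    exact Real.rpow_le_rpow_of_exponent_le (by norm_num) hxh
  have ho' : (5 : ℝ) ^ h * 5 ≤ 2 * o := by
    rw [← pow_succ]
    exact_mod_cast ho
  have : (0 : ℝ) ≤ 5 ^ h := by positivity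
  linarith


/-- Theorem 3 of the paper (second part): if `k ≥ 70`, there exists a nonzero element
of `F_q[x]/⟨x^m − a⟩` whose multiplicative order is at least `5^((m/2)^(1/3))`. -/
theorem exists_element_order_ge_five_pow_cbrt
    (p n q m k l : ℕ) (hp : p.Prime) (hp5 : 5 ≤ p) (hn : 0 < n) (hq : q = p ^ n)
    (hk : 70 ≤ k) (hkdvd : k ∣ q - 1) (hm : m = k * l) (hl : 1 ≤ l)
    (hord : orderOf (q : ZMod m) = l)
    (F : Type*) [Field F] [Fintype F] (hcard : Fintype.card F = q)
    (a : F) (ha : a ≠ 0) (hirr : Irreducible (X ^ m - C a)) :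
    ∃ γ : AdjoinRoot (X ^ m - C a), γ ≠ 0 ∧
      (5 : ℝ) ^ (((m : ℝ) / 2) ^ ((1 : ℝ) / 3)) ≤ (orderOf γ : ℝ) := by
  subst hm hq
  rw [← hcard] at hkdvd hord
  have hm0 : 0 < k * l := by positivity
  rcases le_total (2 * l) (k ^ 2) with h | h
  · exact ⟨_, one_add_root_pow_ne_zero hm0 hl (by nlinarith),
      five_rpow_cbrt_le_of_two_mul_le_sq hk h
        (three_pow_le_two_mul_orderOf ha hirr (by omega) hl rfl hkdvd)⟩
  · have : CharP F p := by
      obtain ⟨p', hchar⟩ := CharP.exists F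
      obtain ⟨n', hp', hcard'⟩ := FiniteField.card F p'
      have hdvd : p ∣ p' ^ (n' : ℕ) := by
        rw [← hcard', hcard]
        exact dvd_pow_self p hn.ne'
      rwa [(Nat.prime_dvd_prime_iff_eq hp hp').1 (hp.dvd_of_dvd_pow hdvd)]
    have hne := one_add_root_pow_ne_zero (a := a) hm0 one_pos (by nlinarith)
    rw [pow_one] at hne
    exact ⟨_, hne, five_rpow_cbrt_le_of_sq_le_two_mul hk h
      (five_pow_sqrt_le_two_mul_orderOf hp5 ha hirr (by omega) hl rfl hkdvd hord)⟩
end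

section
/- For all integers d₀ > 1 and n₀ ≥ d₀², the number q(n₀, d₀) of partitions of n₀ with no part divisible by d₀ satisfies q(n₀, d₀) > (d₀(d₀ − 1)/(160·n₀))^{√d₀} · exp(2.5·√((1 − 1/d₀)·n₀)). -/
/-- The number of partitions of `n` with no part divisible by `d`. -/
def regularPartitionCount (d n : ℕ) : ℕ := (Nat.Partition.restricted n fun i => ¬ d ∣ i).card

theorem ncard_eq_regularPartitionCount (d n : ℕ) :
    {P : Nat.Partition n | ∀ j ∈ P.parts, ¬ d ∣ j}.ncard = regularPartitionCount d n := by
  rw [regularPartitionCount, ← Set.ncard_coe_finset]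
  congr 1
  ext P
  simp [Nat.Partition.restricted]

/-- Adjoin `j` copies of the part `e` to a partition of `n`. -/
def Nat.Partition.adjoin {n m e j : ℕ} (he : 0 < e) (h : n + j * e = m) (P : n.Partition) :
    m.Partition where
  parts := P.parts + Multiset.replicate j e
  parts_pos := by
    intro i hi
    rcases Multiset.mem_add.1 hi with hi | hi
    · exact P.parts_pos hi
    · rwa [Multiset.eq_of_mem_replicate hi]
  parts_sum := by simp [P.parts_sum, h]

theorem regularPartitionCount_le_card_filter {d n m e j : ℕ} (he : 0 < e) (hd : ¬ d ∣ e)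
    (h : n + j * e = m) :
    regularPartitionCount d n ≤
      ((Nat.Partition.restricted m fun i => ¬ d ∣ i).filter fun P => j ≤ P.parts.count e).card := by
  refine Finset.card_le_card_of_injOn (Nat.Partition.adjoin he h) ?_ ?_
  · intro P hP
    simp only [Nat.Partition.restricted, Finset.coe_filter, Finset.mem_univ, true_and,
      Set.mem_ofPred_eq, Finset.mem_filter] at hP ⊢
    refine ⟨fun i hi => ?_, by simp [Nat.Partition.adjoin]⟩
    rcases Multiset.mem_add.1 hi with hi | hi
    · exact hP i hi
    · rwa [Multiset.eq_of_mem_replicate hi]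
  · intro P _ Q _ hPQ
    have := congrArg Nat.Partition.parts hPQ
    exact Nat.Partition.ext (by simpa [Nat.Partition.adjoin] using this)

theorem monotone_regularPartitionCount {d : ℕ} (hd : 1 < d) :
    Monotone (regularPartitionCount d) := by
  refine monotone_nat_of_le_succ fun n => ?_
  refine (regularPartitionCount_le_card_filter (e := 1) (j := 1) one_pos ?_ rfl).trans
    (Finset.card_filter_le _ _)
  rw [Nat.dvd_one]
  omega

theorem regularPartitionCount_zero (d : ℕ) : regularPartitionCount d 0 = 1 := by
  rw [regularPartitionCount, Finset.card_eq_one]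
  refine ⟨default, ?_⟩
  ext P
  simp [Nat.Partition.restricted, Subsingleton.elim P default]

/-- The sum of the divisors of `n` not divisible by `d`. -/
def regularDivisorSum (d n : ℕ) : ℕ :=
  ∑ e ∈ Finset.Icc 1 n, if e ∣ n ∧ ¬ d ∣ e then e else 0

theorem sum_regularDivisorSum_mul_le (d n : ℕ) :
    ∑ k ∈ Finset.Icc 1 n, regularDivisorSum d k * regularPartitionCount d (n - k) ≤
      n * regularPartitionCount d n := by
  set R := Nat.Partition.restricted n fun i => ¬ d ∣ i with hR
  have h1 : ∀ k ∈ Finset.Icc 1 n, regularDivisorSum d k * regularPartitionCount d (n - k) ≤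
      ∑ e ∈ Finset.Icc 1 n, ∑ P ∈ R, if e ∣ k ∧ k ≤ e * P.parts.count e then e else 0 := by
    intro k hk
    rw [Finset.mem_Icc] at hk
    rw [regularDivisorSum, Finset.sum_mul]
    refine (Finset.sum_le_sum fun e he => ?_).trans
      (Finset.sum_le_sum_of_subset (Finset.Icc_subset_Icc_right hk.2))
    rw [Finset.mem_Icc] at he
    split_ifs with h
    · obtain ⟨⟨j, rfl⟩, hde⟩ := h
      have := regularPartitionCount_le_card_filter (d := d) (n := n - e * j) (m := n) (j := j)
        he.1 hde (by rw [mul_comm j e]; omega)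
      rw [← hR, Finset.card_filter] at this
      refine (Nat.mul_le_mul_left e this).trans ?_
      rw [Finset.mul_sum]
      refine Finset.sum_le_sum fun P _ => ?_
      by_cases hj : j ≤ P.parts.count e
      · simp [hj, Nat.mul_le_mul_left e hj]
      · simp [hj]
    · simp
  refine (Finset.sum_le_sum h1).trans ?_
  rw [Finset.sum_comm]
  have h2 : ∀ P ∈ R, ∑ e ∈ Finset.Icc 1 n, ∑ k ∈ Finset.Icc 1 n,
      (if e ∣ k ∧ k ≤ e * P.parts.count e then e else 0) ≤ n := by
    intro P _
    have hsub : P.parts.toFinset ⊆ Finset.Icc 1 n := fun i hi => by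
      rw [Multiset.mem_toFinset] at hi
      exact Finset.mem_Icc.2 ⟨P.parts_pos hi, P.le_of_mem_parts hi⟩
    have hsum := Finset.sum_multiset_count_of_subset P.parts (Finset.Icc 1 n) hsub
    rw [P.parts_sum] at hsum
    conv_rhs => rw [hsum]
    refine Finset.sum_le_sum fun e he => ?_
    rw [Finset.mem_Icc] at he
    rw [← Finset.sum_filter, Finset.sum_const]
    refine Nat.mul_le_mul_right e ?_
    have h3 := Nat.Ioc_filter_dvd_card_eq_div (e * P.parts.count e) e
    rw [Nat.mul_div_cancel_left _ he.1] at h3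
    conv_rhs => rw [← h3]
    refine Finset.card_le_card fun k hk => ?_
    simp only [Finset.mem_filter, Finset.mem_Icc, Finset.mem_Ioc] at hk ⊢
    exact ⟨⟨hk.1.1, hk.2.2⟩, hk.2.1⟩
  calc _ = ∑ P ∈ R, ∑ e ∈ Finset.Icc 1 n, ∑ k ∈ Finset.Icc 1 n,
      (if e ∣ k ∧ k ≤ e * P.parts.count e then e else 0) := by
        exact (Finset.sum_congr rfl fun e _ => Finset.sum_comm).trans Finset.sum_comm
    _ ≤ ∑ P ∈ R, n := Finset.sum_le_sum h2
    _ = n * regularPartitionCount d n := by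
        rw [Finset.sum_const, smul_eq_mul, mul_comm, regularPartitionCount]

theorem sum_range_regularDivisorSum_mul_le (d N : ℕ) :
    ∑ k ∈ Finset.range (N + 1), regularDivisorSum d (k + 1) * regularPartitionCount d (N - k) ≤
      (N + 1) * regularPartitionCount d (N + 1) := by
  have h := sum_regularDivisorSum_mul_le d (N + 1)
  rwa [show Finset.Icc 1 (N + 1) = Finset.Ico (0 + 1) (N + 1 + 1) from rfl,
    ← Finset.sum_Ico_add' (fun k => regularDivisorSum d k * regularPartitionCount d (N + 1 - k)),
    ← Finset.range_eq_Ico, Finset.sum_congr rfl fun k _ => by rw [Nat.add_sub_add_right]] at h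

/-- The sum of the integers up to `m` not divisible by `d`. -/
def regularSum (d m : ℕ) : ℕ := ∑ e ∈ Finset.range m, if ¬ d ∣ e + 1 then e + 1 else 0

theorem two_mul_regularSum_add (d m : ℕ) :
    2 * regularSum d m + d * (m / d * (m / d + 1)) = m * (m + 1) := by
  induction m with
  | zero => simp [regularSum]
  | succ m ih =>
    rw [regularSum, Finset.sum_range_succ, ← regularSum, Nat.succ_div]
    by_cases h : d ∣ m + 1
    · simp only [h, not_true_eq_false, if_true, if_false]
      have h2 : d * (m / d + 1) = m + 1 := by
        have := Nat.mul_div_cancel' h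
        rwa [Nat.succ_div, if_pos h] at this
      nlinarith
    · simp only [h, not_false_eq_true, if_true, if_false]
      nlinarith

theorem pred_mul_sq_le_regularSum {d : ℕ} (hd : 0 < d) (m : ℕ) :
    (d - 1) * m ^ 2 ≤ 2 * d * regularSum d m := by
  obtain ⟨c, rfl⟩ : ∃ c, d = c + 1 := ⟨d - 1, by omega⟩
  have h := two_mul_regularSum_add (c + 1) m
  have h1 : (c + 1) * (m / (c + 1)) ≤ m := Nat.mul_div_le m (c + 1)
  generalize m / (c + 1) = q at *
  rw [Nat.add_sub_cancel]
  nlinarith [Nat.mul_le_mul h1 h1, Nat.mul_le_mul_left (c + 1) h1]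

theorem sum_regularDivisorSum (d K : ℕ) :
    ∑ k ∈ Finset.range K, regularDivisorSum d (k + 1) =
      ∑ j ∈ Finset.range K, regularSum d (K / (j + 1)) := by
  induction K with
  | zero => simp
  | succ K ih =>
    have h0 : ∑ j ∈ Finset.range K, regularSum d (K / (j + 1)) =
        ∑ j ∈ Finset.range (K + 1), regularSum d (K / (j + 1)) := by
      rw [Finset.sum_range_succ, Nat.div_eq_of_lt (Nat.lt_succ_self K)]
      simp [regularSum]
    have h1 : ∀ j ∈ Finset.range (K + 1), regularSum d ((K + 1) / (j + 1)) =
        regularSum d (K / (j + 1)) +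
          if j + 1 ∣ K + 1 ∧ ¬ d ∣ (K + 1) / (j + 1) then (K + 1) / (j + 1) else 0 := by
      intro j _
      rw [Nat.succ_div]
      by_cases h : j + 1 ∣ K + 1
      · simp only [h, if_true, true_and]
        rw [regularSum, Finset.sum_range_succ, ← regularSum]
      · simp [h]
    rw [Finset.sum_range_succ, ih, h0, Finset.sum_congr rfl h1, Finset.sum_add_distrib]
    congr 1
    rw [regularDivisorSum]
    have h2 : ∀ g : ℕ → ℕ, ∑ e ∈ Finset.Icc 1 (K + 1), (if e ∣ K + 1 then g e else 0) =
        ∑ e ∈ (K + 1).divisors, g e := by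
      intro g
      rw [← Finset.sum_filter]
      refine Finset.sum_congr ?_ fun _ _ => rfl
      ext e
      simp only [Finset.mem_filter, Finset.mem_Icc, Nat.mem_divisors]
      constructor
      · rintro ⟨_, h⟩
        exact ⟨h, by omega⟩
      · rintro ⟨h, _⟩
        exact ⟨⟨Nat.pos_of_dvd_of_pos h (by omega), Nat.le_of_dvd (by omega) h⟩, h⟩
    have h3 : ∀ g : ℕ → ℕ, ∑ j ∈ Finset.range (K + 1), g (j + 1) =
        ∑ e ∈ Finset.Icc 1 (K + 1), g e := by
      intro g
      rw [Finset.range_eq_Ico, Finset.sum_Ico_add' g 0 (K + 1) 1]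
      rfl
    rw [h3 fun e => if e ∣ K + 1 ∧ ¬ d ∣ (K + 1) / e then (K + 1) / e else 0]
    simp only [ite_and]
    rw [h2, h2, Nat.sum_div_divisors (K + 1) fun e => if ¬ d ∣ e then e else 0]

theorem sum_sq_div_lower_small : ∀ K < 98, 48 ≤ K →
    157 * (K * (K + 1)) + 86 ≤ 100 * ∑ j ∈ Finset.range K, (K / (j + 1)) ^ 2 + 200 * K := by
  decide +kernel

theorem sum_sq_div_lower_large {K : ℕ} (hK : 98 ≤ K) :
    157 * (K * (K + 1)) + 86 ≤ 100 * ∑ j ∈ Finset.range K, (K / (j + 1)) ^ 2 + 200 * K := by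
  have h1 : ∑ j ∈ Finset.range 30, (((K : ℝ) + 1) / (j + 1) - 1) ^ 2 ≤
      ∑ j ∈ Finset.range K, ((K / (j + 1) : ℕ) : ℝ) ^ 2 := by
    refine (Finset.sum_le_sum fun j hj => ?_).trans (Finset.sum_le_sum_of_subset_of_nonneg
      (Finset.range_subset_range.2 (by omega : 30 ≤ K)) fun _ _ _ => sq_nonneg _)
    have hj' : (j : ℝ) + 1 ≤ K + 1 := by
      have := Finset.mem_range.1 hj
      exact_mod_cast (by omega : j + 1 ≤ K + 1)
    have hlt : (K : ℝ) + 1 ≤ ((K / (j + 1) : ℕ) + 1) * (j + 1) := by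
      have := Nat.lt_div_mul_add (a := K) (Nat.succ_pos j)
      have h2 : K + 1 ≤ (K / (j + 1) + 1) * (j + 1) := by
        rw [Nat.succ_eq_add_one] at this
        linarith
      exact_mod_cast h2
    have hpos : (0 : ℝ) < j + 1 := by positivity
    refine pow_le_pow_left₀ ?_ ?_ 2
    · rwa [sub_nonneg, one_le_div hpos]
    · rw [sub_le_iff_le_add, div_le_iff₀ hpos]
      exact hlt
  have hK' : (98 : ℝ) ≤ K := by exact_mod_cast hK
  have h2 : 157 * ((K : ℝ) * (K + 1)) + 86 ≤
      100 * ∑ j ∈ Finset.range 30, (((K : ℝ) + 1) / (j + 1) - 1) ^ 2 + 200 * K := by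
    norm_num [Finset.sum_range_succ]
    nlinarith
  have h3 : 157 * ((K : ℝ) * (K + 1)) + 86 ≤
      100 * ∑ j ∈ Finset.range K, ((K / (j + 1) : ℕ) : ℝ) ^ 2 + 200 * K := by linarith
  exact_mod_cast h3

theorem sum_regularSum_lower_small : ∀ K < 48, 1 ≤ K → ∀ d < 48, 2 ≤ d →
    157 * (d - 1) * (K * (K + 1)) + 86 * d +
        100 * d * ∑ j ∈ Finset.range K, d * (K / (j + 1) / d * (K / (j + 1) / d + 1)) ≤
      100 * d * ∑ j ∈ Finset.range K, K / (j + 1) * (K / (j + 1) + 1) + 200 * d * K := by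
  decide +kernel

theorem sum_div_lower_small : ∀ K < 48, 1 ≤ K →
    157 * (K * (K + 1)) + 86 ≤
      100 * ∑ j ∈ Finset.range K, K / (j + 1) * (K / (j + 1) + 1) + 200 * K := by
  decide +kernel

theorem sum_regularSum_lower {d K : ℕ} (hd : 2 ≤ d) (hK : 1 ≤ K) :
    157 * (d - 1) * (K * (K + 1)) + 86 * d ≤
      200 * d * ∑ j ∈ Finset.range K, regularSum d (K / (j + 1)) + 200 * d * K := by
  rcases lt_or_ge K 48 with hK48 | hK48
  · have hsum : 2 * ∑ j ∈ Finset.range K, regularSum d (K / (j + 1)) +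
        ∑ j ∈ Finset.range K, d * (K / (j + 1) / d * (K / (j + 1) / d + 1)) =
        ∑ j ∈ Finset.range K, K / (j + 1) * (K / (j + 1) + 1) := by
      rw [Finset.mul_sum, ← Finset.sum_add_distrib]
      exact Finset.sum_congr rfl fun j _ => two_mul_regularSum_add d _
    rcases lt_or_ge d 48 with hd48 | hd48
    · have h := sum_regularSum_lower_small K hK48 hK d hd48 hd
      rw [← hsum] at h
      linarith
    · have h0 : ∑ j ∈ Finset.range K, d * (K / (j + 1) / d * (K / (j + 1) / d + 1)) = 0 := by
        refine Finset.sum_eq_zero fun j _ => ?_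
        rw [Nat.div_eq_of_lt ((Nat.div_le_self K (j + 1)).trans_lt (by omega))]
        simp
      have h := sum_div_lower_small K hK48 hK
      rw [← hsum, h0] at h
      have h1 : 157 * (d - 1) * (K * (K + 1)) ≤ 157 * d * (K * (K + 1)) :=
        Nat.mul_le_mul_right _ (Nat.mul_le_mul_left _ (Nat.sub_le d 1))
      have h2 := Nat.mul_le_mul_left d h
      linarith
  · have hW : 157 * (K * (K + 1)) + 86 ≤
        100 * ∑ j ∈ Finset.range K, (K / (j + 1)) ^ 2 + 200 * K := by
      rcases lt_or_ge K 98 with h | h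
      · exact sum_sq_div_lower_small K h hK48
      · exact sum_sq_div_lower_large h
    have hS : (d - 1) * ∑ j ∈ Finset.range K, (K / (j + 1)) ^ 2 ≤
        2 * d * ∑ j ∈ Finset.range K, regularSum d (K / (j + 1)) := by
      rw [Finset.mul_sum, Finset.mul_sum]
      exact Finset.sum_le_sum fun j _ => pred_mul_sq_le_regularSum (by omega) _
    obtain ⟨c, rfl⟩ : ∃ c, d = c + 1 := ⟨d - 1, by omega⟩
    rw [Nat.add_sub_cancel] at hS ⊢
    have h2 := Nat.mul_le_mul_left c hW
    have h3 : 86 ≤ 200 * K := by omega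
    linarith

/-- The partial sums of the sum-of-divisors function restricted to divisors not divisible by `d`
exceed those of a linear function of slope `1.57 * (1 - 1 / d)`. -/
theorem sum_regularDivisorSum_lower {d K : ℕ} (hd : 2 ≤ d) (hK : 1 ≤ K) :
    1.57 * (1 - 1 / (d : ℝ)) * (K * (K + 1)) / 2 - K + 0.43 ≤
      ∑ k ∈ Finset.range K, (regularDivisorSum d (k + 1) : ℝ) := by
  have h := sum_regularSum_lower hd hK
  rw [← sum_regularDivisorSum] at h
  have hd0 : (0 : ℝ) < d := by
    exact_mod_cast (by omega : 0 < d)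
  have h1 : 157 * ((d : ℝ) - 1) * (K * (K + 1)) + 86 * d ≤
      200 * d * ∑ k ∈ Finset.range K, (regularDivisorSum d (k + 1) : ℝ) + 200 * d * K := by
    have h2 : ((d - 1 : ℕ) : ℝ) = d - 1 := by
      rw [Nat.cast_sub (by omega)]
      simp
    rw [← h2]
    exact_mod_cast h
  generalize ∑ k ∈ Finset.range K, (regularDivisorSum d (k + 1) : ℝ) = S at *
  rw [← mul_le_mul_iff_of_pos_left (show (0 : ℝ) < 200 * d by positivity)]
  have h3 : 200 * (d : ℝ) * (1.57 * (1 - 1 / (d : ℝ)) * (K * (K + 1)) / 2 - K + 0.43) =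
      157 * ((d : ℝ) - 1) * (K * (K + 1)) + 86 * d - 200 * d * K := by
    field_simp
    ring
  linarith

/-- Abel summation: a weighted sum with nonnegative partial weights and antitone nonnegative terms. -/
theorem mul_sum_range_le_sum_range_mul_of_antitone {w b : ℕ → ℝ} (hb : Antitone b)
    (hw : ∀ k, 0 ≤ ∑ i ∈ Finset.range k, w i) (N : ℕ) :
    b N * ∑ i ∈ Finset.range N, w i ≤ ∑ i ∈ Finset.range N, w i * b i := by
  induction N with
  | zero => simp
  | succ N ih =>
    have h1 := mul_le_mul_of_nonneg_right (hb (Nat.le_succ N)) (hw (N + 1))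
    rw [Finset.sum_range_succ] at h1
    rw [Finset.sum_range_succ, Finset.sum_range_succ _ N]
    simp only [Nat.succ_eq_add_one] at h1
    linarith

/-- The coefficient of `x ^ n` in `(1 - x) ^ (-j)`. -/
def negPowCoeff : ℕ → ℕ → ℝ
  | 0, n => if n = 0 then 1 else 0
  | j + 1, n => ((n + j).choose j : ℕ)

theorem negPowCoeff_nonneg (j n : ℕ) : 0 ≤ negPowCoeff j n := by
  cases j with
  | zero => simp only [negPowCoeff]; positivity
  | succ j => simp only [negPowCoeff]; positivity

theorem negPowCoeff_zero_right (j : ℕ) : negPowCoeff j 0 = 1 := by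
  cases j <;> simp [negPowCoeff]

theorem negPowCoeff_succ_succ (j n : ℕ) :
    negPowCoeff (j + 1) (n + 1) = negPowCoeff (j + 1) n + negPowCoeff j (n + 1) := by
  cases j with
  | zero => simp [negPowCoeff]
  | succ j =>
    simp only [negPowCoeff]
    rw [show n + 1 + (j + 1) = (n + j + 1) + 1 by ring, Nat.choose_succ_succ,
      show n + (j + 1) = n + j + 1 by ring, show n + 1 + j = n + j + 1 by ring]
    push_cast
    ring

theorem sum_negPowCoeff (j N : ℕ) :
    ∑ i ∈ Finset.range (N + 1), negPowCoeff j i = negPowCoeff (j + 1) N := by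
  induction N with
  | zero => simp [negPowCoeff_zero_right]
  | succ N ih => rw [Finset.sum_range_succ, ih, negPowCoeff_succ_succ]

theorem sum_mul_eq_sum_sum (a : ℕ → ℝ) (N : ℕ) :
    ∑ i ∈ Finset.range (N + 1), ((N : ℝ) + 1 - i) * a i =
      ∑ n ∈ Finset.range (N + 1), ∑ i ∈ Finset.range (n + 1), a i := by
  induction N with
  | zero => simp
  | succ N ih =>
    rw [Finset.sum_range_succ (fun n => ∑ i ∈ Finset.range (n + 1), a i) (N + 1), ← ih,
      Finset.sum_range_succ a (N + 1), ← add_assoc, ← Finset.sum_add_distrib,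
      Finset.sum_range_succ _ (N + 1)]
    push_cast
    congr 1
    · exact Finset.sum_congr rfl fun i _ => by ring
    · ring

theorem sum_mul_negPowCoeff (j N : ℕ) :
    ∑ i ∈ Finset.range (N + 1), ((N : ℝ) + 1 - i) * negPowCoeff j i = negPowCoeff (j + 2) N := by
  simp only [sum_mul_eq_sum_sum, sum_negPowCoeff]

theorem succ_mul_negPowCoeff (j N : ℕ) :
    ((N : ℝ) + 1) * negPowCoeff j (N + 1) = j * negPowCoeff (j + 1) N := by
  cases j with
  | zero => simp [negPowCoeff]
  | succ j =>
    simp only [negPowCoeff]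
    have h := Nat.choose_succ_right_eq (N + 1 + j) j
    rw [show N + 1 + j - j = N + 1 by omega] at h
    rw [show N + (j + 1) = N + 1 + j by ring]
    have h' : (((N + 1 + j).choose (j + 1) : ℕ) : ℝ) * (j + 1) = ((N + 1 + j).choose j : ℕ) * (N + 1) := by
      exact_mod_cast h
    push_cast
    linarith

/-- The coefficient of `x ^ n` in `1 - x`. -/
def oneSubCoeff : ℕ → ℝ
  | 0 => 1
  | 1 => -1
  | _ + 2 => 0

theorem sum_oneSubCoeff (N : ℕ) :
    ∑ i ∈ Finset.range (N + 1), oneSubCoeff i = negPowCoeff 0 N := by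
  induction N with
  | zero => simp [negPowCoeff, oneSubCoeff]
  | succ N ih =>
    rw [Finset.sum_range_succ, ih]
    cases N <;> simp [negPowCoeff, oneSubCoeff]

theorem sum_mul_oneSubCoeff (N : ℕ) :
    ∑ i ∈ Finset.range (N + 1), ((N : ℝ) + 1 - i) * oneSubCoeff i = 1 := by
  simp only [sum_mul_eq_sum_sum, sum_oneSubCoeff, negPowCoeff]
  simp

theorem succ_mul_oneSubCoeff (N : ℕ) :
    ((N : ℝ) + 1) * oneSubCoeff (N + 1) = - negPowCoeff 0 N := by
  cases N <;> simp [negPowCoeff, oneSubCoeff]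

/-- The coefficient of `x ^ n` in the truncation `∑ j ≤ J, β ^ j / j! * (1 - x) ^ (1 - j)` of
`(1 - x) * exp (β / (1 - x))`. -/
noncomputable def expCoeff (β : ℝ) (J n : ℕ) : ℝ :=
  oneSubCoeff n + ∑ j ∈ Finset.range J, β ^ (j + 1) / (j + 1).factorial * negPowCoeff j n

theorem succ_mul_expCoeff_le {β : ℝ} (hβ : 0 ≤ β) (J N : ℕ) :
    ((N : ℝ) + 1) * expCoeff β J (N + 1) ≤
      ∑ i ∈ Finset.range (N + 1), (β * ((N : ℝ) + 1 - i) - 1) * expCoeff β J i := by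
  set g : ℕ → ℝ := fun j => β ^ (j + 1) / j.factorial * negPowCoeff (j + 1) N with hg
  have hR : ∑ i ∈ Finset.range (N + 1), (β * ((N : ℝ) + 1 - i) - 1) * expCoeff β J i =
      β - negPowCoeff 0 N + ∑ j ∈ Finset.range J, β ^ (j + 1) / (j + 1).factorial *
        (β * negPowCoeff (j + 2) N - negPowCoeff (j + 1) N) := by
    simp only [expCoeff, mul_add, Finset.sum_add_distrib, Finset.mul_sum]
    congr 1
    · have h : β = ∑ i ∈ Finset.range (N + 1), β * (((N : ℝ) + 1 - i) * oneSubCoeff i) := by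
        rw [← Finset.mul_sum, sum_mul_oneSubCoeff, mul_one]
      conv_rhs => rw [h]
      rw [← sum_oneSubCoeff, ← Finset.sum_sub_distrib]
      exact Finset.sum_congr rfl fun i _ => by ring
    · rw [Finset.sum_comm]
      refine Finset.sum_congr rfl fun j _ => ?_
      rw [← sum_mul_negPowCoeff, ← sum_negPowCoeff, Finset.mul_sum, ← Finset.sum_sub_distrib,
        Finset.mul_sum]
      exact Finset.sum_congr rfl fun i _ => by ring
  have hL : ((N : ℝ) + 1) * expCoeff β J (N + 1) = - negPowCoeff 0 N +
      ∑ j ∈ Finset.range J, β ^ (j + 1) / (j + 1).factorial * (j * negPowCoeff (j + 1) N) := by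
    simp only [expCoeff, mul_add, succ_mul_oneSubCoeff, Finset.mul_sum, ← succ_mul_negPowCoeff]
    congr 1
    exact Finset.sum_congr rfl fun i _ => by ring
  have hT := Finset.sum_range_sub g J
  have hg0 : g 0 = β := by simp [hg, negPowCoeff]
  have hgJ : 0 ≤ g J := mul_nonneg (by positivity) (negPowCoeff_nonneg _ _)
  have hD : ∑ j ∈ Finset.range J, (g (j + 1) - g j) =
      ∑ j ∈ Finset.range J, β ^ (j + 1) / (j + 1).factorial *
        (β * negPowCoeff (j + 2) N - negPowCoeff (j + 1) N) -
      ∑ j ∈ Finset.range J, β ^ (j + 1) / (j + 1).factorial * (j * negPowCoeff (j + 1) N) := by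
    rw [← Finset.sum_sub_distrib]
    refine Finset.sum_congr rfl fun j _ => ?_
    simp only [hg, Nat.factorial_succ]
    push_cast
    field_simp
    ring
  rw [hR, hL]
  linarith

theorem expCoeff_nonneg {β : ℝ} (hβ : 0 ≤ β) (J : ℕ) {n : ℕ} (hn : n ≠ 1) :
    0 ≤ expCoeff β J n := by
  refine add_nonneg ?_ (Finset.sum_nonneg fun j _ => mul_nonneg (by positivity)
    (negPowCoeff_nonneg _ _))
  match n, hn with
  | 0, _ => simp [oneSubCoeff]
  | n + 2, _ => simp [oneSubCoeff]

theorem neg_one_le_expCoeff_one {β : ℝ} (hβ : 0 ≤ β) (J : ℕ) : -1 ≤ expCoeff β J 1 := by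
  have : 0 ≤ ∑ j ∈ Finset.range J, β ^ (j + 1) / (j + 1).factorial * negPowCoeff j 1 :=
    Finset.sum_nonneg fun j _ => mul_nonneg (by positivity) (negPowCoeff_nonneg _ _)
  simp only [expCoeff, oneSubCoeff]
  linarith

theorem expCoeff_zero_le {β : ℝ} (hβ : 0 ≤ β) (J : ℕ) : expCoeff β J 0 ≤ Real.exp β := by
  refine le_trans (le_of_eq ?_) (Real.sum_le_exp_of_nonneg hβ (J + 1))
  rw [Finset.sum_range_succ']
  simp [expCoeff, oneSubCoeff, negPowCoeff_zero_right, add_comm]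

/-- A sequence whose weights `s` have large partial sums dominates the coefficients of
`exp (-β) * (1 - x) * exp (β / (1 - x))`. -/
theorem exp_neg_mul_expCoeff_le {f : ℕ → ℝ} {s : ℕ → ℝ} {β : ℝ} (hβ : 0.785 ≤ β)
    (hmono : Monotone f) (hf0 : f 0 = 1)
    (hrec : ∀ N : ℕ, ∑ k ∈ Finset.range (N + 1), s k * f (N - k) ≤ ((N : ℝ) + 1) * f (N + 1))
    (hs : ∀ K : ℕ, 1 ≤ K → β * (K * (K + 1)) / 2 - K + 0.43 ≤ ∑ k ∈ Finset.range K, s k)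
    (J n : ℕ) : Real.exp (-β) * expCoeff β J n ≤ f n := by
  have hβ0 : 0 ≤ β := by linarith
  have hf1 : ∀ n, 1 ≤ f n := fun n => hf0 ▸ hmono (Nat.zero_le n)
  have hc0 := Real.exp_pos (-β)
  have hc1 : Real.exp (-β) ≤ 1 := Real.exp_le_one_iff.2 (by linarith)
  set e : ℕ → ℝ := fun k => β * (k + 1) - 1 + if k = 0 then 0.43 else 0 with he
  have hesum : ∀ K : ℕ, 1 ≤ K → ∑ k ∈ Finset.range K, e k = β * (K * (K + 1)) / 2 - K + 0.43 := by
    intro K hK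
    induction K, hK using Nat.le_induction with
    | base =>
      simp [he]
      ring
    | succ K hK ih =>
      rw [Finset.sum_range_succ, ih]
      simp only [he, if_neg (show K ≠ 0 by omega)]
      push_cast
      ring
  induction n using Nat.strong_induction_on with
  | _ n ih =>
  rcases n with _ | N
  · rw [hf0, Real.exp_neg, inv_mul_le_iff₀ (Real.exp_pos β), mul_one]
    exact expCoeff_zero_le hβ0 J
  have hdom : ∑ k ∈ Finset.range (N + 1), e k * f (N - k) ≤
      ∑ k ∈ Finset.range (N + 1), s k * f (N - k) := by
    have hw : ∀ K, 0 ≤ ∑ k ∈ Finset.range K, (s k - e k) := by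
      intro K
      rcases K with _ | K
      · simp
      · rw [Finset.sum_sub_distrib, hesum _ (by omega), sub_nonneg]
        exact hs _ (by omega)
    have hb : Antitone fun k => f (N - k) := fun a b hab => hmono (by omega)
    have h := mul_sum_range_le_sum_range_mul_of_antitone hb hw (N + 1)
    have h0 := mul_nonneg (zero_le_one.trans (hf1 (N - (N + 1)))) (hw (N + 1))
    have h1 := h0.trans h
    simp only [sub_mul, Finset.sum_sub_distrib] at h1
    linarith
  have hterm : ∀ i ∈ Finset.range (N + 1),
      Real.exp (-β) * ((β * ((N : ℝ) + 1 - i) - 1) * expCoeff β J i) ≤ e (N - i) * f i := by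
    intro i hi
    have hi' : i ≤ N := by simpa [Nat.lt_succ_iff] using hi
    have hfi := ih i (by omega)
    have hcast : ((N - i : ℕ) : ℝ) = N - i := by push_cast [hi']; ring
    rcases eq_or_lt_of_le hi' with rfl | hlt
    · simp only [he, Nat.sub_self, if_true, Nat.cast_zero]
      by_cases hh : 0 ≤ expCoeff β J i
      · have h2 : 0 ≤ Real.exp (-β) * expCoeff β J i := by positivity
        nlinarith [mul_le_mul_of_nonneg_left hfi (show 0 ≤ β - 0.57 by linarith)]
      · have hi1 : i = 1 := by
          by_contra hne
          exact hh (expCoeff_nonneg hβ0 J hne)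
        subst hi1
        have h3 := neg_one_le_expCoeff_one hβ0 J
        have h4 : -1 ≤ Real.exp (-β) * expCoeff β J 1 := by nlinarith
        have h5 : Real.exp (-β) * expCoeff β J 1 ≤ 0 := by nlinarith
        have h6 := hf1 1
        rcases le_total 1 β with h | h
        · nlinarith
        · nlinarith
    · have hlt' : (i : ℝ) + 1 ≤ N := by exact_mod_cast hlt
      simp only [he, hcast, if_neg (show N - i ≠ 0 by omega)]
      have h7 : 0 ≤ β * ((N : ℝ) + 1 - i) - 1 := by nlinarith
      calc _ = (β * ((N : ℝ) + 1 - i) - 1) * (Real.exp (-β) * expCoeff β J i) := by ring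
        _ ≤ (β * ((N : ℝ) + 1 - i) - 1) * f i := mul_le_mul_of_nonneg_left hfi h7
        _ = _ := by ring
  have hrefl : ∑ k ∈ Finset.range (N + 1), e k * f (N - k) =
      ∑ i ∈ Finset.range (N + 1), e (N - i) * f i := by
    rw [← Finset.sum_range_reflect]
    refine Finset.sum_congr rfl fun i hi => ?_
    have hi' : i ≤ N := by simpa [Nat.lt_succ_iff] using hi
    rw [show N + 1 - 1 - i = N - i by omega, show N - (N - i) = i by omega]
  have h1 := mul_le_mul_of_nonneg_left (succ_mul_expCoeff_le hβ0 J N) hc0.le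
  rw [Finset.mul_sum] at h1
  have h2 := Finset.sum_le_sum hterm
  have h3 : ((N : ℝ) + 1) * (Real.exp (-β) * expCoeff β J (N + 1)) ≤ ((N : ℝ) + 1) * f (N + 1) := by
    have := hrec N
    linarith
  exact le_of_mul_le_mul_left h3 (by positivity)

theorem exp_neg_mul_expCoeff_le_regularPartitionCount {d : ℕ} (hd : 2 ≤ d) (J n : ℕ) :
    Real.exp (-(1.57 * (1 - 1 / (d : ℝ)))) * expCoeff (1.57 * (1 - 1 / (d : ℝ))) J n ≤
      regularPartitionCount d n := by
  have hd' : (2 : ℝ) ≤ d := by exact_mod_cast hd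
  have hinv : 1 / (d : ℝ) ≤ 1 / 2 := one_div_le_one_div_of_le two_pos hd'
  refine exp_neg_mul_expCoeff_le (f := fun n => (regularPartitionCount d n : ℝ))
    (s := fun k => (regularDivisorSum d (k + 1) : ℝ)) (by linarith) ?_ ?_ ?_ ?_ J n
  · exact fun a b hab => Nat.cast_le.2 (monotone_regularPartitionCount (by omega) hab)
  · simp [regularPartitionCount_zero]
  · intro N
    exact_mod_cast sum_range_regularDivisorSum_mul_le d N
  · intro K hK
    exact sum_regularDivisorSum_lower hd hK

theorem three_mul_four_pow_mul_factorial_le (i : ℕ) :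
    3 * 4 ^ (i + 1) * (i.factorial * (i + 2).factorial) ≤ 4 * (2 * (i + 1) + 1).factorial := by
  induction i with
  | zero => decide
  | succ i ih =>
    rw [show 2 * (i + 1 + 1) + 1 = (2 * (i + 1) + 1) + 1 + 1 by ring,
      Nat.factorial_succ (2 * (i + 1) + 1 + 1), Nat.factorial_succ (2 * (i + 1) + 1),
      Nat.factorial_succ i,
      show i + 1 + 2 = i + 2 + 1 by ring, Nat.factorial_succ (i + 2), pow_succ]
    calc _ = 4 * ((i + 1) * (i + 3)) * (3 * 4 ^ (i + 1) * (i.factorial * (i + 2).factorial)) := by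
          ring
      _ ≤ (2 * (i + 1) + 1 + 1 + 1) * (2 * (i + 1) + 1 + 1) *
          (4 * (2 * (i + 1) + 1).factorial) := by
          refine Nat.mul_le_mul ?_ ih
          nlinarith
      _ = _ := by ring

theorem sinh_terms_le_expCoeff_terms {β z : ℝ} (hβ : 0 ≤ β) (hz : 0 < z) {n : ℕ} (hn : 0 < n)
    (hzn : z ^ 2 = 4 * β * n) (i : ℕ) :
    3 * β / (4 * n * z) * (z ^ (2 * (i + 1) + 1) / (2 * (i + 1) + 1).factorial) ≤
      β ^ (i + 2) / (i + 2).factorial * negPowCoeff (i + 1) n := by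
  have hn0 : (0 : ℝ) < n := by exact_mod_cast hn
  have h1 : (n : ℝ) ^ i / i.factorial ≤ negPowCoeff (i + 1) n := by
    rw [div_le_iff₀ (by positivity)]
    have := Nat.pow_succ_le_ascFactorial (n + 1) i
    rw [Nat.ascFactorial_eq_factorial_mul_choose] at this
    have h2 := (Nat.pow_le_pow_left (Nat.le_succ n) i).trans this
    rw [mul_comm] at h2
    simp only [negPowCoeff]
    exact_mod_cast h2
  refine le_trans ?_ (mul_le_mul_of_nonneg_left h1 (by positivity))
  have h3 : (3 * 4 ^ (i + 1) * (i.factorial * (i + 2).factorial) : ℝ) ≤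
      4 * (2 * (i + 1) + 1).factorial := by
    exact_mod_cast three_mul_four_pow_mul_factorial_le i
  have h4 : z ^ (2 * (i + 1) + 1) = (4 ^ (i + 1) * β ^ (i + 1) * n ^ (i + 1)) * z := by
    rw [pow_succ, pow_mul, hzn, mul_pow, mul_pow]
  rw [h4]
  have h5 : 3 * β / (4 * n * z) * ((4 ^ (i + 1) * β ^ (i + 1) * n ^ (i + 1)) * z /
      (2 * (i + 1) + 1).factorial) =
      β ^ (i + 2) * n ^ i * (3 * 4 ^ (i + 1) / (4 * (2 * (i + 1) + 1).factorial)) := by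
    field_simp
    ring
  have h6 : β ^ (i + 2) / ((i + 2).factorial : ℝ) * (n ^ i / i.factorial) =
      β ^ (i + 2) * n ^ i * (1 / (i.factorial * (i + 2).factorial)) := by
    field_simp
  rw [h5, h6]
  refine mul_le_mul_of_nonneg_left ?_ (by positivity)
  rw [div_le_div_iff₀ (by positivity) (by positivity), one_mul]
  exact h3

theorem sinh_le_of_expCoeff_le {β z c y : ℝ} (hβ : 0 ≤ β) (hz : 0 < z) (hc : 0 ≤ c) {n : ℕ}
    (hn : 2 ≤ n) (hzn : z ^ 2 = 4 * β * n) (h : ∀ J, c * expCoeff β J n ≤ y) :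
    c * (3 * β / (4 * n * z) * (Real.sinh z - z)) ≤ y := by
  have hlim := (Real.hasSum_sinh z).tendsto_sum_nat.comp (Filter.tendsto_add_atTop_nat 1)
  have hlim2 := ((hlim.sub_const z).const_mul (3 * β / (4 * n * z))).const_mul c
  refine le_of_tendsto' hlim2 fun J => le_trans (mul_le_mul_of_nonneg_left ?_ hc) (h (J + 1))
  obtain ⟨m, rfl⟩ : ∃ m, n = m + 2 := ⟨n - 2, by omega⟩
  simp only [Function.comp_apply]
  rw [Finset.sum_range_succ', expCoeff, Finset.sum_range_succ' (fun j =>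
    β ^ (j + 1) / ((j + 1).factorial : ℝ) * negPowCoeff j (m + 2))]
  have h0 : z ^ (2 * 0 + 1) / ((2 * 0 + 1).factorial : ℝ) = z := by simp
  rw [h0, add_sub_cancel_right, Finset.mul_sum]
  have h1 := Finset.sum_le_sum fun i (_ : i ∈ Finset.range J) =>
    sinh_terms_le_expCoeff_terms hβ hz (by omega : 0 < m + 2) hzn i
  simpa [oneSubCoeff, negPowCoeff] using h1

theorem exp_div_three_le_sinh_sub {z : ℝ} (hz : 3.5 ≤ z) : Real.exp z / 3 ≤ Real.sinh z - z := by
  have h1 : Real.exp z = Real.exp 1 ^ 3 * Real.exp (z - 3) := by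
    rw [← Real.exp_nat_mul, ← Real.exp_add]
    congr 1
    push_cast
    ring
  have h2 : (19 : ℝ) ≤ Real.exp 1 ^ 3 :=
    le_trans (by norm_num) (pow_le_pow_left₀ (by norm_num) Real.exp_one_gt_d9.le 3)
  have h3 := Real.quadratic_le_exp_of_nonneg (show 0 ≤ z - 3 by linarith)
  have h4 : Real.exp (-z) ≤ 1 := Real.exp_le_one_iff.2 (by linarith)
  have h5 : 6 * z + 3 ≤ Real.exp z := by
    rw [h1]
    nlinarith [Real.exp_pos (z - 3)]
  rw [Real.sinh_eq]
  linarith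

theorem log_le_div_two_add {r : ℝ} (hr : 0 < r) : Real.log r ≤ r / 2 - 1 + Real.log 2 := by
  have h := Real.log_le_sub_one_of_pos (show 0 < r / 2 by positivity)
  rw [Real.log_div hr.ne' two_ne_zero] at h
  linarith

/-- The comparison of prefactors and exponents, on the logarithmic scale. -/
theorem log_bound_lt {d n : ℕ} (hd : 2 ≤ d) (hn : d ^ 2 ≤ n) {β : ℝ}
    (hβ : β = 1.57 * (1 - 1 / (d : ℝ))) :
    Real.log ((d : ℝ) * ((d : ℝ) - 1) / (160 * (n : ℝ))) * √(d : ℝ) +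
        2.5 * √((1 - 1 / (d : ℝ)) * (n : ℝ)) <
      -β + Real.log β / 2 - 3 * Real.log 2 - 3 / 2 * Real.log n + 2 * √(β * n) := by
  have hd' : (2 : ℝ) ≤ d := by exact_mod_cast hd
  have hn' : (d : ℝ) ^ 2 ≤ n := by exact_mod_cast hn
  have hn0 : (0 : ℝ) < n := by nlinarith
  have hl2 := Real.log_two_gt_d9
  have hl2' := Real.log_two_lt_d9
  have hinv : 1 / (d : ℝ) ≤ 1 / 2 := one_div_le_one_div_of_le two_pos hd'
  have hinv0 : 0 < 1 / (d : ℝ) := by positivity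
  have hx0 : 0 ≤ Real.log n := Real.log_natCast_nonneg n
  rcases eq_or_lt_of_le hd with rfl | hd3
  · have hβ2 : β = 0.785 := by rw [hβ]; norm_num
    have hlogβ : -0.5 ≤ Real.log β := by
      have h := Real.one_sub_inv_le_log_of_pos (show 0 < β by rw [hβ2]; norm_num)
      rw [hβ2] at h ⊢
      refine le_trans ?_ h
      norm_num
    have hs : √((1 - 1 / ((2 : ℕ) : ℝ)) * (n : ℝ)) ≤ 0.70711 * √(n : ℝ) := by
      rw [Real.sqrt_mul (by norm_num)]
      refine mul_le_mul_of_nonneg_right ?_ (Real.sqrt_nonneg _)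
      rw [Real.sqrt_le_left (by norm_num)]
      norm_num
    have hs2 : 0.886 * √(n : ℝ) ≤ √(β * n) := by
      rw [Real.sqrt_mul (by rw [hβ2]; norm_num)]
      refine mul_le_mul_of_nonneg_right ?_ (Real.sqrt_nonneg _)
      apply Real.le_sqrt_of_sq_le
      rw [hβ2]
      norm_num
    have hr1 : 1.414 ≤ √((2 : ℕ) : ℝ) := by
      apply Real.le_sqrt_of_sq_le
      norm_num
    have hx : Real.log n ≤ 2 * (√(n : ℝ) / 64 - 1 + 6 * Real.log 2) := by
      have hsn : 0 < √(n : ℝ) := Real.sqrt_pos.2 hn0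
      have h := Real.log_le_sub_one_of_pos (show 0 < √(n : ℝ) / 64 by positivity)
      rw [Real.log_div hsn.ne' (by norm_num), Real.log_sqrt hn0.le,
        show (64 : ℝ) = 2 ^ 6 by norm_num, Real.log_pow] at h
      norm_num at h ⊢
      linarith
    have hlog : Real.log (((2 : ℕ) : ℝ) * (((2 : ℕ) : ℝ) - 1) / (160 * (n : ℝ))) ≤
        - (6 * Real.log 2) - Real.log n := by
      rw [show ((2 : ℕ) : ℝ) * (((2 : ℕ) : ℝ) - 1) / (160 * (n : ℝ)) = (80 * (n : ℝ))⁻¹ by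
        push_cast; field_simp; norm_num, Real.log_inv, Real.log_mul (by norm_num) hn0.ne']
      have : Real.log (2 ^ 6) ≤ Real.log 80 := Real.log_le_log (by norm_num) (by norm_num)
      rw [Real.log_pow] at this
      push_cast at this
      linarith
    have hsn0 := Real.sqrt_nonneg (n : ℝ)
    have h1 : Real.log (((2 : ℕ) : ℝ) * (((2 : ℕ) : ℝ) - 1) / (160 * (n : ℝ))) * √((2 : ℕ) : ℝ) ≤
        (- (6 * Real.log 2) - Real.log n) * 1.414 := by
      refine (mul_le_mul_of_nonneg_right hlog (Real.sqrt_nonneg _)).trans ?_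
      nlinarith
    linarith
  · have hd3' : (3 : ℝ) ≤ d := by exact_mod_cast hd3
    have hinv3 : 1 / (d : ℝ) ≤ 1 / 3 := one_div_le_one_div_of_le three_pos hd3'
    have hβ1 : 1 ≤ β := by rw [hβ]; linarith
    have hβ2 : β ≤ 1.57 := by rw [hβ]; linarith
    have hlogβ := Real.log_nonneg hβ1
    have hr : 1.5 ≤ √(d : ℝ) := by
      apply Real.le_sqrt_of_sq_le
      norm_num
      linarith
    have hr0 : 0 < √(d : ℝ) := by linarith
    have hL : Real.log d ≤ 2 * (√(d : ℝ) / 2 - 1 + Real.log 2) := by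
      have h := log_le_div_two_add hr0
      rw [Real.log_sqrt (by linarith)] at h
      linarith
    have hsq : 2.5 * √((1 - 1 / (d : ℝ)) * (n : ℝ)) ≤ 2 * √(β * n) := by
      have h : 1.25 * √((1 - 1 / (d : ℝ)) * (n : ℝ)) ≤ √(β * n) := by
        apply Real.le_sqrt_of_sq_le
        have h0 : 0 ≤ (1 - 1 / (d : ℝ)) * (n : ℝ) := mul_nonneg (by linarith) hn0.le
        rw [mul_pow, Real.sq_sqrt h0, hβ]
        nlinarith
      linarith
    have h2L : 2 * Real.log d ≤ Real.log n := by
      have h := Real.log_le_log (by positivity) hn'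
      rw [Real.log_pow] at h
      exact_mod_cast h
    have hlog : Real.log ((d : ℝ) * ((d : ℝ) - 1) / (160 * (n : ℝ))) ≤
        2 * Real.log d - 5 - Real.log n := by
      rw [Real.log_div (by nlinarith) (by positivity), Real.log_mul (by linarith) (by linarith),
        Real.log_mul (by norm_num) hn0.ne']
      have h1 : Real.log ((d : ℝ) - 1) ≤ Real.log d := Real.log_le_log (by linarith) (by linarith)
      have h5 : 5 ≤ Real.log 160 := by
        rw [Real.le_log_iff_exp_le (by norm_num), show (5 : ℝ) = (5 : ℕ) * 1 by norm_num,
          Real.exp_nat_mul]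
        exact (pow_le_pow_left₀ (Real.exp_pos 1).le Real.exp_one_lt_d9.le 5).trans (by norm_num)
      linarith
    have h1 : Real.log ((d : ℝ) * ((d : ℝ) - 1) / (160 * (n : ℝ))) * √(d : ℝ) ≤
        (2 * Real.log d - Real.log n) * 1.5 - 5 * √(d : ℝ) := by
      refine (mul_le_mul_of_nonneg_right hlog hr0.le).trans ?_
      nlinarith
    linarith

/-- Maróti: for integers `d₀ > 1` and `n₀ ≥ d₀²`, the number `q(n₀, d₀)` of
partitions of `n₀` with no part divisible by `d₀` satisfies
`q(n₀, d₀) > (d₀(d₀ − 1)/(160·n₀))^√d₀ · exp(2.5·√((1 − 1/d₀)·n₀))`. -/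
theorem maroti_q_lower_bound (n₀ d₀ : ℕ) (hd : 1 < d₀) (hn : d₀ ^ 2 ≤ n₀) :
    ((d₀ : ℝ) * ((d₀ : ℝ) - 1) / (160 * (n₀ : ℝ))) ^ Real.sqrt (d₀ : ℝ) *
        Real.exp (2.5 * Real.sqrt ((1 - 1 / (d₀ : ℝ)) * (n₀ : ℝ))) <
      ({P : Nat.Partition n₀ | ∀ j ∈ P.parts, ¬ d₀ ∣ j}.ncard : ℝ) := by
  rw [ncard_eq_regularPartitionCount]
  have hd' : (2 : ℝ) ≤ d₀ := by exact_mod_cast hd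
  have hn4 : 4 ≤ n₀ := le_trans (by nlinarith) hn
  have hn4' : (4 : ℝ) ≤ n₀ := by exact_mod_cast hn4
  have hn0 : (0 : ℝ) < n₀ := by linarith
  have hinv : 1 / (d₀ : ℝ) ≤ 1 / 2 := one_div_le_one_div_of_le two_pos hd'
  have hcoeff := fun J => exp_neg_mul_expCoeff_le_regularPartitionCount hd J n₀
  have hlog := log_bound_lt hd hn rfl
  set β : ℝ := 1.57 * (1 - 1 / (d₀ : ℝ)) with hβ
  have hβ1 : 0.785 ≤ β := by linarith
  have hβ0 : 0 < β := by linarith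
  have hβn : 0 ≤ β * n₀ := by positivity
  set z : ℝ := 2 * √(β * n₀) with hz
  have hz1 : 3.5 ≤ z := by
    have : 1.75 ≤ √(β * n₀) := by
      apply Real.le_sqrt_of_sq_le
      nlinarith
    linarith
  have hz0 : 0 < z := by linarith
  have hzn : z ^ 2 = 4 * β * n₀ := by
    rw [hz, mul_pow, Real.sq_sqrt hβn]
    ring
  have h1 := sinh_le_of_expCoeff_le hβ0.le hz0 (Real.exp_pos (-β)).le (by omega) hzn hcoeff
  refine lt_of_lt_of_le ?_ h1
  have h2 : Real.exp (-β) * (3 * β / (4 * n₀ * z) * (Real.exp z / 3)) ≤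
      Real.exp (-β) * (3 * β / (4 * n₀ * z) * (Real.sinh z - z)) := by
    gcongr
    exact exp_div_three_le_sinh_sub hz1
  refine lt_of_lt_of_le ?_ h2
  have hbase : 0 < (d₀ : ℝ) * ((d₀ : ℝ) - 1) / (160 * (n₀ : ℝ)) :=
    div_pos (mul_pos (by linarith) (by linarith)) (by positivity)
  rw [Real.rpow_def_of_pos hbase, ← Real.exp_add]
  have h3 : Real.exp (-β) * (3 * β / (4 * n₀ * z) * (Real.exp z / 3)) =
      Real.exp (-β + Real.log β / 2 - 3 * Real.log 2 - 3 / 2 * Real.log n₀ + z) := by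
    rw [← Real.exp_log (show 0 < 3 * β / (4 * n₀ * z) by positivity),
      ← Real.exp_log (show 0 < Real.exp z / 3 by positivity), ← Real.exp_add, ← Real.exp_add]
    congr 1
    rw [Real.log_div (by positivity) (by positivity), Real.log_mul (by norm_num) hβ0.ne',
      Real.log_mul (by positivity) hz0.ne', Real.log_mul (by norm_num) hn0.ne',
      Real.log_div (Real.exp_pos z).ne' (by norm_num), Real.log_exp, hz,
      Real.log_mul two_ne_zero (by positivity), Real.log_sqrt hβn,
      Real.log_mul hβ0.ne' hn0.ne', show (4 : ℝ) = 2 ^ 2 by norm_num, Real.log_pow]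
    push_cast
    ring
  rw [h3]
  exact Real.exp_lt_exp.2 hlog
end
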